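/- A linear circuit C is cancellation-free if and only if for every pair of vertices v_1, v_2 of C there do not exist two vertex-disjoint (apart from endpoints) directed paths from v_1 to v_2, and this holds if and only if for every vertex v and index i with κ(v)_i = 0 there is no directed path from input x_i to v. -/

import Mathlib

/-- A linear circuit over `F_2` with `n` inputs, given as a straight-line program.
Vertices `0, …, n-1` are the inputs `x_1, …, x_n`; vertex `n + g` is gate `g`.
Each gate has in-degree two: its two children `left g` and `right g` are earlier
vertices, and the gate computes the XOR of its children. -/
structure LinCircuit (n : ℕ) where
  gates : ℕ
  left : Fin gates → ℕ
  right : Fin gates → ℕ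
  left_lt : ∀ g, left g < n + g.val
  right_lt : ∀ g, right g < n + g.val

namespace LinCircuit

variable {n : ℕ}

/-- The value vector `κ(v) ∈ F_2^n` of the vertex `v`: for an input `x_i` it is
the `i`-th standard unit vector, and for a gate it is the sum of the value
vectors of its two children. -/
def val (C : LinCircuit n) (v : ℕ) : Fin n → ZMod 2 :=
  if _h1 : v < n then fun j => if (j : ℕ) = v then 1 else 0
  else if h2 : v - n < C.gates then
    C.val (C.left ⟨v - n, h2⟩) + C.val (C.right ⟨v - n, h2⟩)
  else 0
termination_by v
decreasing_by
  · have := C.left_lt ⟨v - n, h2⟩; simp only [Fin.val_mk] at this; omega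
  · have := C.right_lt ⟨v - n, h2⟩; simp only [Fin.val_mk] at this; omega

/-- `C` computes the `m × n` matrix `A` if there are `m` designated output
vertices whose value vectors are exactly the rows of `A`. -/
def Computes {m : ℕ} (C : LinCircuit n) (A : Matrix (Fin m) (Fin n) (ZMod 2)) : Prop :=
  ∃ out : Fin m → ℕ, (∀ o, out o < n + C.gates) ∧ ∀ o j, C.val (out o) j = A o j

/-- `Edge C w u`: there is a wire from vertex `w` to vertex `u`,
i.e. `u` is a gate having `w` as one of its two children. -/
def Edge (C : LinCircuit n) (w u : ℕ) : Prop :=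
  ∃ g : Fin C.gates, u = n + g.val ∧ (C.left g = w ∨ C.right g = w)

/-- A circuit is cancellation-free if along every directed path the value
vectors only grow in the coordinatewise partial order. -/
def CancellationFree (C : LinCircuit n) : Prop :=
  ∀ w u : ℕ, Relation.TransGen C.Edge w u → ∀ i : Fin n, C.val w i = 1 → C.val u i = 1

end LinCircuit

namespace LinCircuit

variable {n : ℕ}

/-- The source vertex of a wire of the circuit.  A wire is a gate together with
a choice of one of its two in-coming edges (`true` for the left child, `false`
for the right child); this makes the two parallel edges of a gate whose two
children coincide distinct wires. -/
def wireSrc (C : LinCircuit n) (w : Fin C.gates × Bool) : ℕ :=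
  if w.2 then C.left w.1 else C.right w.1

/-- The target vertex of a wire (the gate it enters). -/
def wireTgt (C : LinCircuit n) (w : Fin C.gates × Bool) : ℕ :=
  n + (w.1 : ℕ)

/-- `l` is a (nonempty) directed path of wires from vertex `v₁` to vertex `v₂`. -/
def IsWirePath (C : LinCircuit n) (v₁ v₂ : ℕ) (l : List (Fin C.gates × Bool)) : Prop :=
  l ≠ [] ∧ l.Chain' (fun a b => C.wireTgt a = C.wireSrc b) ∧
    l.head?.map C.wireSrc = some v₁ ∧ l.getLast?.map C.wireTgt = some v₂

/-- The internal vertices of a path of wires, i.e. all visited vertices apart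
from the two endpoints. -/
def internalVertices (C : LinCircuit n) (l : List (Fin C.gates × Bool)) : List ℕ :=
  l.dropLast.map C.wireTgt

end LinCircuit

namespace LinCircuit

variable {n : ℕ}

theorem edge_lt {C : LinCircuit n} {a b : ℕ} (h : C.Edge a b) : a < b := by
  obtain ⟨g, rfl, h | h⟩ := h
  · rw [← h]; exact C.left_lt g
  · rw [← h]; exact C.right_lt g

theorem rt_le {C : LinCircuit n} {a b : ℕ} (h : Relation.ReflTransGen C.Edge a b) : a ≤ b := by
  induction h with
  | refl => exact le_rfl
  | tail _ h2 ih => exact ih.trans (edge_lt h2).le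

theorem t_lt {C : LinCircuit n} {a b : ℕ} (h : Relation.TransGen C.Edge a b) : a < b := by
  induction h with
  | single h => exact edge_lt h
  | tail _ h2 ih => exact ih.trans (edge_lt h2)

theorem val_input (C : LinCircuit n) (i : Fin n) (v : ℕ) (hv : v < n) :
    C.val v i = if (i : ℕ) = v then 1 else 0 := by
  rw [val]; simp [hv]

theorem val_gate (C : LinCircuit n) (i : Fin n) (g : Fin C.gates) :
    C.val (n + g) i = C.val (C.left g) i + C.val (C.right g) i := by
  rw [val]; simp

theorem vertex_cases (C : LinCircuit n) {v : ℕ} (hv : v < n + C.gates) :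
    v < n ∨ ∃ g : Fin C.gates, v = n + g := by
  by_cases h : v < n
  · exact Or.inl h
  · exact Or.inr ⟨⟨v - n, by omega⟩, by simp; omega⟩

theorem zmod_cases (a : ZMod 2) : a = 0 ∨ a = 1 := by
  revert a; decide

theorem edge_left (C : LinCircuit n) (g : Fin C.gates) : C.Edge (C.left g) (n + g) :=
  ⟨g, rfl, Or.inl rfl⟩

theorem edge_right (C : LinCircuit n) (g : Fin C.gates) : C.Edge (C.right g) (n + g) :=
  ⟨g, rfl, Or.inr rfl⟩

theorem reach_of_val (C : LinCircuit n) (i : Fin n) (v : ℕ) (h : C.val v i ≠ 0) :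
    Relation.ReflTransGen C.Edge (i : ℕ) v := by
  induction v using Nat.strong_induction_on with
  | _ v ih =>
    by_cases hv : v < n + C.gates
    · rcases C.vertex_cases hv with h1 | ⟨g, rfl⟩
      · rw [val_input C i v h1] at h
        have : (i : ℕ) = v := by by_contra hh; simp [hh] at h
        rw [this]
      · rw [val_gate] at h
        by_cases hl : C.val (C.left g) i = 0
        · by_cases hr : C.val (C.right g) i = 0
          · simp [hl, hr] at h
          · exact (ih _ (C.right_lt g) hr).tail (C.edge_right g)
        · exact (ih _ (C.left_lt g) hl).tail (C.edge_left g)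
    · exfalso; apply h
      rw [val]; simp [show ¬ v < n by omega, show ¬ v - n < C.gates by omega]

theorem exists_input (C : LinCircuit n) (v : ℕ) (hv : v < n + C.gates) :
    ∃ i : Fin n, Relation.ReflTransGen C.Edge (i : ℕ) v := by
  induction v using Nat.strong_induction_on with
  | _ v ih =>
    rcases C.vertex_cases hv with h1 | ⟨g, rfl⟩
    · exact ⟨⟨v, h1⟩, .refl⟩
    · obtain ⟨i, hi⟩ := ih _ (C.left_lt g) (by have := C.left_lt g; omega)
      exact ⟨i, hi.tail (C.edge_left g)⟩

theorem edge_wire (C : LinCircuit n) (w : Fin C.gates × Bool) :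
    C.Edge (C.wireSrc w) (C.wireTgt w) := by
  obtain ⟨g, b⟩ := w
  cases b
  · exact C.edge_right g
  · exact C.edge_left g

theorem wire_of_edge {C : LinCircuit n} {a b : ℕ} (h : C.Edge a b) :
    ∃ w, C.wireSrc w = a ∧ C.wireTgt w = b := by
  obtain ⟨g, rfl, h | h⟩ := h
  · exact ⟨(g, true), by simpa [wireSrc] using h, rfl⟩
  · exact ⟨(g, false), by simpa [wireSrc] using h, rfl⟩

theorem path_single (C : LinCircuit n) (w : Fin C.gates × Bool) :
    C.IsWirePath (C.wireSrc w) (C.wireTgt w) [w] := by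
  refine ⟨by simp, ?_, by simp, by simp⟩
  exact List.isChain_singleton _

theorem path_snoc_iff (C : LinCircuit n) (a b : ℕ) (P : List (Fin C.gates × Bool)) (hP : P ≠ [])
    (w : Fin C.gates × Bool) :
    C.IsWirePath a b (P ++ [w]) ↔ C.IsWirePath a (C.wireSrc w) P ∧ C.wireTgt w = b := by
  obtain ⟨Q, z, rfl⟩ := List.eq_nil_or_concat'  P |>.resolve_left hP
  have e : (Q ++ [z] ++ [w]).head? = (Q ++ [z]).head? := by cases Q <;> simp
  unfold IsWirePath
  rw [e, List.getLast?_concat, List.getLast?_concat]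
  have hc : List.IsChain (fun a b => C.wireTgt a = C.wireSrc b) (Q ++ [z] ++ [w]) ↔
      List.IsChain (fun a b => C.wireTgt a = C.wireSrc b) (Q ++ [z]) ∧
        C.wireTgt z = C.wireSrc w := by
    rw [List.isChain_append (l₁ := Q ++ [z])]
    simp [-List.append_assoc]
  simp only [List.Chain', hc, Option.map_some, Option.some.injEq]
  have h1 : Q ++ [z] ++ [w] ≠ [] := by simp
  tauto

theorem path_cases {C : LinCircuit n} {a b : ℕ} {l : List (Fin C.gates × Bool)}
    (h : C.IsWirePath a b l) :
    ∃ P w, l = P ++ [w] ∧ C.wireTgt w = b ∧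
      ((P = [] ∧ C.wireSrc w = a) ∨ C.IsWirePath a (C.wireSrc w) P) := by
  obtain ⟨P, w, rfl⟩ := List.eq_nil_or_concat' l |>.resolve_left h.1
  refine ⟨P, w, rfl, ?_⟩
  by_cases hP : P = []
  · subst hP
    obtain ⟨_, _, h3, h4⟩ := h
    simp at h3 h4
    exact ⟨h4, Or.inl ⟨rfl, h3⟩⟩
  · rw [path_snoc_iff C a b P hP w] at h
    exact ⟨h.2, Or.inr h.1⟩

theorem path_trans (C : LinCircuit n) (a : ℕ) (l : List (Fin C.gates × Bool)) : ∀ b,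
    C.IsWirePath a b l → Relation.TransGen C.Edge a b := by
  induction l using List.reverseRecOn with
  | nil => intro b h; exact absurd rfl h.1
  | append_singleton P w ih =>
    intro b h
    obtain ⟨P', w', he, rfl, h⟩ := path_cases h
    obtain ⟨rfl, h2⟩ := List.append_inj' he rfl
    obtain rfl : w = w' := by simpa using h2
    rcases h with ⟨_, rfl⟩ | h
    · exact .single (C.edge_wire w)
    · exact (ih _ h).tail (C.edge_wire w)

theorem path_last_mem {C : LinCircuit n} {a b : ℕ} {l : List (Fin C.gates × Bool)}
    (h : C.IsWirePath a b l) : b ∈ l.map C.wireTgt := by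
  obtain ⟨P, w, rfl, rfl, _⟩ := path_cases h
  simp

theorem exists_path {C : LinCircuit n} {a b : ℕ} (h : Relation.ReflTransGen C.Edge a b) :
    ∃ P : List (Fin C.gates × Bool),
      (∀ w, C.wireSrc w = b → C.IsWirePath a (C.wireTgt w) (P ++ [w])) ∧
      ∀ x ∈ P.map C.wireTgt, a < x ∧ Relation.ReflTransGen C.Edge x b := by
  induction h with
  | refl => exact ⟨[], fun w hw => by rw [← hw]; exact C.path_single w, by simp⟩
  | @tail b c h1 h2 ih =>
    obtain ⟨P, hP, hx⟩ := ih
    obtain ⟨w, hs, ht⟩ := wire_of_edge h2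
    refine ⟨P ++ [w], fun z hz => ?_, fun x hxm => ?_⟩
    · rw [path_snoc_iff _ _ _ _ (by simp)]
      refine ⟨?_, rfl⟩
      rw [hz, ← ht]; exact hP w hs
    · rw [List.map_append, List.mem_append] at hxm
      rcases hxm with hxm | hxm
      · exact ⟨(hx x hxm).1, (hx x hxm).2.tail h2⟩
      · obtain rfl : x = c := by simpa [ht] using hxm
        exact ⟨(rt_le h1).trans_lt (edge_lt h2), .refl⟩

theorem exists_disjoint (C : LinCircuit n) (g : Fin C.gates) (a : ℕ)
    (hl : Relation.ReflTransGen C.Edge a (C.left g))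
    (hr : Relation.ReflTransGen C.Edge a (C.right g)) :
    ∃ (v₁ v₂ : ℕ) (p q : List (Fin C.gates × Bool)),
        C.IsWirePath v₁ v₂ p ∧ C.IsWirePath v₁ v₂ q ∧ p ≠ q ∧
          (C.internalVertices p).Disjoint (C.internalVertices q) := by
  classical
  let S : ℕ → Prop := fun u => Relation.ReflTransGen C.Edge u (C.left g) ∧
    Relation.ReflTransGen C.Edge u (C.right g)
  have hS : S (Nat.findGreatest S (C.left g)) :=
    Nat.findGreatest_spec (P := S) (rt_le hl) ⟨hl, hr⟩
  have hmax : ∀ x, S x → x ≤ Nat.findGreatest S (C.left g) := fun x hx =>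
    Nat.le_findGreatest (rt_le hx.1) hx
  obtain ⟨P, hP, hPx⟩ := exists_path hS.1
  obtain ⟨Q, hQ, hQx⟩ := exists_path hS.2
  refine ⟨_, n + g, P ++ [(g, true)], Q ++ [(g, false)], hP (g, true) (by simp [wireSrc]),
    hQ (g, false) (by simp [wireSrc]), ?_, ?_⟩
  · intro h
    have := (List.append_inj' h rfl).2
    simp at this
  · intro x hx hy
    simp only [internalVertices, List.dropLast_concat] at hx hy
    have h1 := hPx x hx
    have h2 := hQx x hy
    have := hmax x ⟨h1.2, h2.2⟩
    omega

theorem val_one_of_reach (C : LinCircuit n)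
    (hC : ¬ ∃ (v₁ v₂ : ℕ) (p q : List (Fin C.gates × Bool)),
        C.IsWirePath v₁ v₂ p ∧ C.IsWirePath v₁ v₂ q ∧ p ≠ q ∧
          (C.internalVertices p).Disjoint (C.internalVertices q))
    (i : Fin n) (v : ℕ) (h : Relation.ReflTransGen C.Edge (i : ℕ) v) : C.val v i = 1 := by
  induction v using Nat.strong_induction_on with
  | _ v ih =>
    rcases Relation.ReflTransGen.cases_tail h with rfl | ⟨c, hc, hcv⟩
    · rw [val_input C i _ i.2]; simp
    · obtain ⟨g, rfl, hg⟩ := hcv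
      rw [val_gate]
      have key : ¬ (Relation.ReflTransGen C.Edge (i : ℕ) (C.left g) ∧
          Relation.ReflTransGen C.Edge (i : ℕ) (C.right g)) := fun hh =>
        hC (C.exists_disjoint g i hh.1 hh.2)
      rcases hg with rfl | rfl
      · have : C.val (C.right g) i = 0 := by
          by_contra hh; exact key ⟨hc, C.reach_of_val i _ hh⟩
        rw [ih _ (C.left_lt g) hc, this, add_zero]
      · have : C.val (C.left g) i = 0 := by
          by_contra hh; exact key ⟨C.reach_of_val i _ hh, hc⟩
        rw [ih _ (C.right_lt g) hc, this, zero_add]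

theorem cf_val_one {C : LinCircuit n} (hC : C.CancellationFree) (i : Fin n) (v : ℕ)
    (h : Relation.ReflTransGen C.Edge (i : ℕ) v) : C.val v i = 1 := by
  have h0 : C.val (i : ℕ) i = 1 := by rw [val_input C i _ i.2]; simp
  rcases Relation.reflTransGen_iff_eq_or_transGen.1 h with rfl | h
  · exact h0
  · exact hC _ _ h i h0

theorem cf_no_paths {C : LinCircuit n} (hC : C.CancellationFree) {v₁ v₂ : ℕ}
    {p q : List (Fin C.gates × Bool)}
    (hp : C.IsWirePath v₁ v₂ p) (hq : C.IsWirePath v₁ v₂ q) (hne : p ≠ q)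
    (hd : (C.internalVertices p).Disjoint (C.internalVertices q)) : False := by
  obtain ⟨P, w, rfl, hw, hP⟩ := path_cases hp
  obtain ⟨Q, z, rfl, hz, hQ⟩ := path_cases hq
  simp only [internalVertices, List.dropLast_concat] at hd
  have rP : Relation.ReflTransGen C.Edge v₁ (C.wireSrc w) := by
    rcases hP with ⟨_, h⟩ | h
    · rw [h]
    · exact (C.path_trans _ _ _ h).to_reflTransGen
  have rQ : Relation.ReflTransGen C.Edge v₁ (C.wireSrc z) := by
    rcases hQ with ⟨_, h⟩ | h
    · rw [h]
    · exact (C.path_trans _ _ _ h).to_reflTransGen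
  by_cases hwz : w = z
  · subst hwz
    rcases hP with ⟨rfl, h⟩ | h <;> rcases hQ with ⟨rfl, h'⟩ | h'
    · exact hne rfl
    · have := t_lt (C.path_trans _ _ _ h'); omega
    · have := t_lt (C.path_trans _ _ _ h); omega
    · exact hd (path_last_mem h) (path_last_mem h')
  · have hv : v₁ < n + C.gates := by
      have h1 := t_lt (C.path_trans _ _ _ hp)
      have h2 := w.1.2
      simp only [wireTgt] at hw
      omega
    obtain ⟨i, hi⟩ := C.exists_input v₁ hv
    have e1 := cf_val_one hC i _ (hi.trans rP)
    have e2 := cf_val_one hC i _ (hi.trans rQ)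
    have e3 := cf_val_one hC i _ ((hi.trans rP).tail (C.edge_wire w))
    obtain ⟨g, b⟩ := w
    obtain ⟨g', b'⟩ := z
    simp only [wireTgt] at hw hz e3
    obtain rfl : g = g' := Fin.ext (by omega)
    rw [val_gate] at e3
    cases b <;> cases b' <;> simp [wireSrc] at hwz e1 e2 <;> rw [e1, e2] at e3 <;>
      exact absurd e3 (by decide)

end LinCircuit

/-- A linear circuit `C` is cancellation-free if and only if
for every pair of vertices `v₁, v₂` of `C` there do not exist two
vertex-disjoint (apart from endpoints) directed paths from `v₁` to `v₂`, and
this holds if and only if for every vertex `v` and index `i` with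
`κ(v)_i = 0` there is no directed path from the input `x_i` to `v`. -/
theorem cancellationFree_iff_no_disjoint_paths (n : ℕ) (C : LinCircuit n) :
    (C.CancellationFree ↔
      ¬ ∃ (v₁ v₂ : ℕ) (p q : List (Fin C.gates × Bool)),
        C.IsWirePath v₁ v₂ p ∧ C.IsWirePath v₁ v₂ q ∧ p ≠ q ∧
          (C.internalVertices p).Disjoint (C.internalVertices q)) ∧
    (C.CancellationFree ↔
      ∀ v : ℕ, v < n + C.gates → ∀ i : Fin n, C.val v i = 0 →
        ¬ Relation.TransGen C.Edge (i : ℕ) v) := by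
  have h12 := fun hC : C.CancellationFree =>
    (fun ⟨_, _, _, _, hp, hq, hne, hd⟩ => LinCircuit.cf_no_paths hC hp hq hne hd :
      ¬ ∃ (v₁ v₂ : ℕ) (p q : List (Fin C.gates × Bool)),
        C.IsWirePath v₁ v₂ p ∧ C.IsWirePath v₁ v₂ q ∧ p ≠ q ∧
          (C.internalVertices p).Disjoint (C.internalVertices q))
  refine ⟨⟨h12, fun h w u hwu i hw => ?_⟩, fun hC v _ i h0 ht => ?_, fun h w u hwu i hw => ?_⟩
  · exact C.val_one_of_reach h i u
      ((C.reach_of_val i w (by rw [hw]; decide)).trans hwu.to_reflTransGen)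
  · rw [LinCircuit.cf_val_one hC i v ht.to_reflTransGen] at h0
    exact absurd h0 (by decide)
  · have hu : u < n + C.gates := by
      obtain ⟨c, _, g, rfl, _⟩ := Relation.TransGen.tail'_iff.1 hwu
      have := g.2
      omega
    rcases LinCircuit.zmod_cases (C.val u i) with h0 | h1
    · exact absurd (Relation.TransGen.trans_right
        (C.reach_of_val i w (by rw [hw]; decide)) hwu) (h u hu i h0)
    · exact h1
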